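/- Suppose the KKT conditions, MFCQ, and the second-order condition all hold at z* (Assumption A). Then z* is an isolated stationary point of NLP (there is a neighborhood of z* containing no other point at which the KKT conditions hold with some multiplier) and a strict local minimizer of NLP (φ(z) > φ(z*) for every feasible z ≠ z* in some neighborhood of z*). -/

import Mathlib

open scoped RealInnerProductSpace
open Metric Set

noncomputable section

/-- Euclidean space ℝ^n. -/
abbrev En (n : ℕ) := EuclideanSpace ℝ (Fin n)

/-- The Lagrangian L(z,λ) = φ(z) + λᵀ g(z). -/
def Lagr {n m : ℕ} (φ : En n → ℝ) (g : Fin m → En n → ℝ) (z : En n) (l : En m) : ℝ :=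
  φ z + ∑ i, l i * g i z

/-- ∇_z L(z,λ). -/
def gradL {n m : ℕ} (φ : En n → ℝ) (g : Fin m → En n → ℝ) (l : En m) (z : En n) : En n :=
  gradient (fun z' => Lagr φ g z' l) z

/-- ∇²_{zz} L(z,λ), as a continuous linear map. -/
def hessL {n m : ℕ} (φ : En n → ℝ) (g : Fin m → En n → ℝ) (l : En m) (z : En n) :
    En n →L[ℝ] En n :=
  fderiv ℝ (gradL φ g l) z

/-- The KKT conditions at a point z with multiplier λ. -/
def KKTat {n m : ℕ} (φ : En n → ℝ) (g : Fin m → En n → ℝ) (z : En n) (l : En m) : Prop :=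
  gradL φ g l z = 0 ∧ (∀ i, g i z ≤ 0) ∧ (∀ i, 0 ≤ l i) ∧ ∑ i, l i * g i z = 0

/-- The set S_λ of optimal multipliers at z*. -/
def Slam {n m : ℕ} (φ : En n → ℝ) (g : Fin m → En n → ℝ) (zs : En n) : Set (En m) :=
  {l | KKTat φ g zs l}

/-- The active set B. -/
def ActB {n m : ℕ} (g : Fin m → En n → ℝ) (zs : En n) : Set (Fin m) := {i | g i zs = 0}

/-- Strongly active constraints B₊. -/
def Bplus {n m : ℕ} (φ : En n → ℝ) (g : Fin m → En n → ℝ) (zs : En n) : Set (Fin m) :=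
  {i | g i zs = 0 ∧ ∃ l ∈ Slam φ g zs, 0 < l i}

/-- Weakly active constraints B₀ = B \ B₊. -/
def Bzero {n m : ℕ} (φ : En n → ℝ) (g : Fin m → En n → ℝ) (zs : En n) : Set (Fin m) :=
  ActB g zs \ Bplus φ g zs

/-- Mangasarian–Fromovitz constraint qualification at z*. -/
def MFCQ {n m : ℕ} (g : Fin m → En n → ℝ) (zs : En n) : Prop :=
  ∃ y : En n, ∀ i ∈ ActB g zs, ⟪gradient (g i) zs, y⟫ < 0

/-- The second-order sufficient condition. -/
def SOC {n m : ℕ} (φ : En n → ℝ) (g : Fin m → En n → ℝ) (zs : En n) : Prop :=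
  ∃ σ : ℝ, 0 < σ ∧ ∀ l ∈ Slam φ g zs, ∀ w : En n,
    (∀ i ∈ Bplus φ g zs, ⟪gradient (g i) zs, w⟫ = 0) →
    (∀ i ∈ Bzero φ g zs, ⟪gradient (g i) zs, w⟫ ≤ 0) →
    σ * ‖w‖ ^ 2 ≤ ⟪w, hessL φ g l zs w⟫

/-- φ and g twice Lipschitz continuously differentiable near z*. -/
def Smooth2 {n m : ℕ} (φ : En n → ℝ) (g : Fin m → En n → ℝ) (zs : En n) : Prop :=
  ∃ U ∈ nhds zs, ContDiffOn ℝ 2 φ U ∧ (∀ i, ContDiffOn ℝ 2 (g i) U) ∧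
    ∃ K : NNReal, LipschitzOnWith K (fun z => fderiv ℝ (fderiv ℝ φ) z) U ∧
      ∀ i, LipschitzOnWith K (fun z => fderiv ℝ (fderiv ℝ (g i)) z) U

/-- Assumption A: smoothness, KKT, MFCQ and the second-order condition hold at z*. -/
def AssumpA {n m : ℕ} (φ : En n → ℝ) (g : Fin m → En n → ℝ) (zs : En n) : Prop :=
  Smooth2 φ g zs ∧ (∃ l : En m, KKTat φ g zs l) ∧ MFCQ g zs ∧ SOC φ g zs

/-- δ(z,λ) = dist((z,λ), S) where S = {z*} × S_λ (Euclidean product norm). -/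
def deltaP {n m : ℕ} (φ : En n → ℝ) (g : Fin m → En n → ℝ) (zs : En n)
    (z : En n) (l : En m) : ℝ :=
  Real.sqrt (‖z - zs‖ ^ 2 + (Metric.infDist l (Slam φ g zs)) ^ 2)

/-- η(z,λ) = ‖(∇_z L(z,λ), min(λ, −g(z)))‖. -/
def eta {n m : ℕ} (φ : En n → ℝ) (g : Fin m → En n → ℝ) (z : En n) (l : En m) : ℝ :=
  Real.sqrt (‖gradL φ g l z‖ ^ 2 + ∑ i, (min (l i) (-(g i z))) ^ 2)

/-- The estimated active set A(z,λ) = {i : g_i(z) ≥ −η(z,λ)^τ}. -/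
def Aest {n m : ℕ} (φ : En n → ℝ) (g : Fin m → En n → ℝ) (τ : ℝ) (z : En n) (l : En m) :
    Set (Fin m) :=
  {i | -(eta φ g z l) ^ τ ≤ g i z}

/-- Feasibility for the linear program LP(Â) (independent of Â): componentwise bounds on
∇φ(z) + Σ_i λ̃_i ∇g_i(z), nonnegativity on A(z,λ), and λ̃_i = 0 off A(z,λ). -/
def LPFeasible {n m : ℕ} (φ : En n → ℝ) (g : Fin m → En n → ℝ) (τ : ℝ)
    (z : En n) (l : En m) (lt : En m) : Prop :=
  (∀ j : Fin n, |(gradient φ z + ∑ i, lt i • gradient (g i) z) j| ≤ (eta φ g z l) ^ τ) ∧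
  (∀ i ∈ Aest φ g τ z l, 0 ≤ lt i) ∧ (∀ i ∉ Aest φ g τ z l, lt i = 0)

/-- The objective Σ_{i ∈ Â} λ̃_i of LP(Â). -/
def lpObj {m : ℕ} (Ah : Set (Fin m)) (lt : En m) : ℝ :=
  ∑ i, Ah.indicator (fun i => lt i) i

/-- λ̃ is an optimal solution of LP(Â). -/
def LPOptimal {n m : ℕ} (φ : En n → ℝ) (g : Fin m → En n → ℝ) (τ : ℝ)
    (z : En n) (l : En m) (Ah : Set (Fin m)) (lt : En m) : Prop :=
  LPFeasible φ g τ z l lt ∧ ∀ lt', LPFeasible φ g τ z l lt' → lpObj Ah lt' ≤ lpObj Ah lt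

/-- The initial working set Â_init of Procedure ID0. -/
def initSet {n m : ℕ} (φ : En n → ℝ) (g : Fin m → En n → ℝ) (τ th : ℝ)
    (z : En n) (l : En m) : Set (Fin m) :=
  Aest φ g τ z l \ {i | (eta φ g z l) ^ th ≤ l i}

/-- One pass of the repeat loop of Procedure ID0 that does not stop:
an optimal solution λ̃ of LP(Â) is chosen, C = {i ∈ Â : λ̃_i ≥ η^τ̂} is nonempty,
and the working set is updated to Â \ C. -/
def ID0Step {n m : ℕ} (φ : En n → ℝ) (g : Fin m → En n → ℝ) (τ th : ℝ)
    (z : En n) (l : En m) (Ah Ah' : Set (Fin m)) : Prop :=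
  ∃ lt, LPOptimal φ g τ z l Ah lt ∧
    {i | i ∈ Ah ∧ (eta φ g z l) ^ th ≤ lt i} ≠ ∅ ∧
    Ah' = Ah \ {i | i ∈ Ah ∧ (eta φ g z l) ^ th ≤ lt i}

/-- (A₀, A₊) is a possible output of Procedure ID0 on input (z,λ). -/
def ID0Out {n m : ℕ} (φ : En n → ℝ) (g : Fin m → En n → ℝ) (τ th : ℝ)
    (z : En n) (l : En m) (A0 Ap : Set (Fin m)) : Prop :=
  ∃ Ah : Set (Fin m),
    Relation.ReflTransGen (ID0Step φ g τ th z l) (initSet φ g τ th z l) Ah ∧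
    ((∃ lt, LPOptimal φ g τ z l Ah lt ∧
        {i | i ∈ Ah ∧ (eta φ g z l) ^ th ≤ lt i} = ∅ ∧
        A0 = Ah ∧ Ap = Aest φ g τ z l \ Ah) ∨
     (∃ lt, LPOptimal φ g τ z l Ah lt ∧
        {i | i ∈ Ah ∧ (eta φ g z l) ^ th ≤ lt i} ≠ ∅ ∧
        Ah \ {i | i ∈ Ah ∧ (eta φ g z l) ^ th ≤ lt i} = ∅ ∧
        A0 = ∅ ∧ Ap = Aest φ g τ z l))

/-- Feasibility for the linear program (intlam). -/
def IntFeasible {n m : ℕ} (φ : En n → ℝ) (g : Fin m → En n → ℝ) (τ : ℝ)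
    (z : En n) (l : En m) (Ap : Set (Fin m)) (t : ℝ) (lh : En m) : Prop :=
  (∀ i ∈ Ap, t ≤ lh i) ∧
  (∀ j : Fin n, |(gradient φ z + ∑ i, lh i • gradient (g i) z) j| ≤ (eta φ g z l) ^ τ) ∧
  (∀ i ∈ Ap, 0 ≤ lh i) ∧ (∀ i ∉ Ap, lh i = 0)

/-- (t̂, λ̂) is an optimal solution of (intlam). -/
def IntOptimal {n m : ℕ} (φ : En n → ℝ) (g : Fin m → En n → ℝ) (τ : ℝ)
    (z : En n) (l : En m) (Ap : Set (Fin m)) (t : ℝ) (lh : En m) : Prop :=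
  IntFeasible φ g τ z l Ap t lh ∧
  ∀ t' lh', IntFeasible φ g τ z l Ap t' lh' → t' ≤ t

/-- ε_λ = max_{λ* ∈ S_λ} min_{i ∈ B₊} λ*_i. -/
def epsLam {n m : ℕ} (φ : En n → ℝ) (g : Fin m → En n → ℝ) (zs : En n) : ℝ :=
  ⨆ l ∈ Slam φ g zs, ⨅ i ∈ Bplus φ g zs, l i

/-- S_λ^ν = {λ ∈ S_λ : min_{i∈B₊} λ_i ≥ ν ε_λ}. -/
def SlamNu {n m : ℕ} (φ : En n → ℝ) (g : Fin m → En n → ℝ) (zs : En n) (ν : ℝ) :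
    Set (En m) :=
  {l ∈ Slam φ g zs | ∀ i ∈ Bplus φ g zs, ν * epsLam φ g zs ≤ l i}

/-- (Δz, λ⁺) solves the stabilized SQP subproblem at (z,λ) with parameter μ. -/
def SSQPSol {n m : ℕ} (φ : En n → ℝ) (g : Fin m → En n → ℝ)
    (z : En n) (l : En m) (μ : ℝ) (dz : En n) (lp : En m) : Prop :=
  hessL φ g l z dz + gradient φ z + ∑ i, lp i • gradient (g i) z = 0 ∧
  (∀ i, 0 ≤ lp i) ∧
  (∀ i, g i z + ⟪gradient (g i) z, dz⟫ - μ * (lp i - l i) ≤ 0) ∧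
  ∑ i, lp i * (g i z + ⟪gradient (g i) z, dz⟫ - μ * (lp i - l i)) = 0

/-- Euclidean distance between primal-dual pairs. -/
def pdist {n m : ℕ} (p q : En n × En m) : ℝ :=
  Real.sqrt (‖p.1 - q.1‖ ^ 2 + ‖p.2 - q.2‖ ^ 2)

open Filter Topology

section Directional

variable {E F ι : Type*} [NormedAddCommGroup E] [InnerProductSpace ℝ E]
  [NormedAddCommGroup F] [NormedSpace ℝ F]

/-- Along any net of points tending to `x` with limiting direction `w`, normalized difference
quotients converge to the derivative in the direction `w`. -/
lemma HasFDerivAt.tendsto_normalized_sub {f : E → F} {f' : E →L[ℝ] F} {x w : E}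
    (hf : HasFDerivAt f f' x) {l : Filter ι} {p : ι → E} (hp : Tendsto p l (𝓝 x))
    (hw : Tendsto (fun k => ‖p k - x‖⁻¹ • (p k - x)) l (𝓝 w)) :
    Tendsto (fun k => ‖p k - x‖⁻¹ • (f (p k) - f x)) l (𝓝 (f' w)) := by
  have hd : Tendsto (fun k => p k - x) l (𝓝 0) := by
    simpa using hp.sub_const x
  simpa using (hasFDerivWithinAt_univ.2 hf).lim hd (.of_forall fun _ => mem_univ _) hw

/-- If a map vanishing at `x` is, up to a second-order error, nonincreasing along the displacement
from `x`, then its derivative is nonpositive in the limiting direction. -/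
lemma HasFDerivAt.inner_apply_nonpos {f : E → E} {f' : E →L[ℝ] E} {x w : E}
    (hf : HasFDerivAt f f' x) (hx : f x = 0) {l : Filter ι} [l.NeBot] {p : ι → E}
    (hp : Tendsto p l (𝓝 x)) (hne : ∀ᶠ k in l, p k ≠ x)
    (hw : Tendsto (fun k => ‖p k - x‖⁻¹ • (p k - x)) l (𝓝 w))
    {e : ι → ℝ} (he : Tendsto e l (𝓝 0))
    (h : ∀ᶠ k in l, ⟪p k - x, f (p k)⟫ ≤ e k * ‖p k - x‖ ^ 2) :
    ⟪w, f' w⟫ ≤ 0 := by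
  refine le_of_tendsto_of_tendsto (hw.inner (hf.tendsto_normalized_sub hp hw)) he ?_
  filter_upwards [hne, h] with k hk hle
  have hpos : 0 < ‖p k - x‖ := norm_pos_iff.2 (sub_ne_zero.2 hk)
  rw [hx, sub_zero, real_inner_smul_left, real_inner_smul_right, ← mul_assoc, ← mul_inv,
    inv_mul_le_iff₀ (by positivity)]
  linarith

/-- A property that holds frequently near `x` holds along an ultrafilter of points with a limiting
direction. -/
lemma exists_ultrafilter_tendsto_direction [FiniteDimensional ℝ E] {x : E} {P : E → Prop}
    (h : ∃ᶠ z in 𝓝[≠] x, P z) :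
    ∃ u : Ultrafilter E, ↑u ≤ 𝓝[≠] x ∧ (∀ᶠ z in (u : Filter E), P z) ∧
      ∃ w : E, ‖w‖ = 1 ∧ Tendsto (fun z => ‖z - x‖⁻¹ • (z - x)) u (𝓝 w) := by
  have hne : (𝓝[≠] x ⊓ 𝓟 {z | P z}).NeBot := frequently_mem_iff_neBot.1 h
  let u := Ultrafilter.of (𝓝[≠] x ⊓ 𝓟 {z | P z})
  have hu : (u : Filter E) ≤ 𝓝[≠] x ⊓ 𝓟 {z | P z} := Ultrafilter.of_le _
  have hux : (u : Filter E) ≤ 𝓝[≠] x := hu.trans inf_le_left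
  refine ⟨u, hux, hu.trans inf_le_right (mem_principal_self _), ?_⟩
  have hsphere : ∀ᶠ z in (u : Filter E), ‖z - x‖⁻¹ • (z - x) ∈ sphere (0 : E) 1 := by
    filter_upwards [hux self_mem_nhdsWithin] with z hz
    have : ‖z - x‖ ≠ 0 := norm_ne_zero_iff.2 (sub_ne_zero.2 hz)
    simp [norm_smul, this]
  have := FiniteDimensional.proper ℝ E
  obtain ⟨w, hw, hlim⟩ := (isCompact_sphere (0 : E) 1).ultrafilter_le_nhds
    (u.map fun z => ‖z - x‖⁻¹ • (z - x)) (le_principal_iff.2 hsphere)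
  exact ⟨w, by simpa using hw, hlim⟩

end Directional

section Gradient

variable {E : Type*} [NormedAddCommGroup E] [InnerProductSpace ℝ E] [CompleteSpace E]

lemma ContDiffAt.differentiableAt_gradient {f : E → ℝ} {x : E} (hf : ContDiffAt ℝ 2 f x) :
    DifferentiableAt ℝ (gradient f) x := by
  have h : DifferentiableAt ℝ (fderiv ℝ f) x :=
    (hf.fderiv_right (m := 1) (by norm_num)).differentiableAt (by norm_num)
  exact (InnerProductSpace.toDual ℝ E).symm.differentiableAt.comp x h

/-- Mean value theorem on the segment from `x` to a nearby point, in terms of the gradient. -/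
lemma eventually_exists_sub_eq_inner_gradient {f : E → ℝ} {x : E}
    (hf : ∀ᶠ z in 𝓝 x, DifferentiableAt ℝ f z) :
    ∀ᶠ z in 𝓝 x, ∃ t ∈ Ioo (0 : ℝ) 1,
      f z - f x = ⟪gradient f (x + t • (z - x)), z - x⟫ := by
  obtain ⟨r, hr, hball⟩ := Metric.eventually_nhds_iff_ball.1 hf
  filter_upwards [ball_mem_nhds x hr] with z hz
  have hd : ∀ t ∈ Icc (0 : ℝ) 1, HasDerivAt (fun t : ℝ => f (x + t • (z - x)))
      ⟪gradient f (x + t • (z - x)), z - x⟫ t := by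
    intro t ht
    have hmem : x + t • (z - x) ∈ ball x r :=
      (convex_ball x r).add_smul_sub_mem (mem_ball_self hr) hz ht
    have hline : HasDerivAt (fun t : ℝ => x + t • (z - x)) (z - x) t := by
      simpa using ((hasDerivAt_id t).smul_const (z - x)).const_add x
    rw [inner_gradient_left]
    exact (hball _ hmem).hasFDerivAt.comp_hasDerivAt t hline
  obtain ⟨t, ht, heq⟩ := exists_hasDerivAt_eq_slope (fun t : ℝ => f (x + t • (z - x))) _
    zero_lt_one (fun t ht => (hd t ht).continuousAt.continuousWithinAt)
    (fun t ht => hd t (Ioo_subset_Icc_self ht))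
  exact ⟨t, ht, by simpa using heq.symm⟩

/-- The first-order expansion based at the moving point has a quadratic error. -/
lemma ContDiffAt.exists_abs_inner_gradient_sub_le {f : E → ℝ} {x : E} (hf : ContDiffAt ℝ 2 f x) :
    ∃ C : ℝ, ∀ᶠ z in 𝓝 x, |⟪gradient f z, z - x⟫ - (f z - f x)| ≤ C * ‖z - x‖ ^ 2 := by
  obtain ⟨C, hC⟩ := hf.differentiableAt_gradient.isBigO_sub.bound
  obtain ⟨r, hr, hball⟩ := Metric.eventually_nhds_iff_ball.1 hC
  have hdiff : ∀ᶠ z in 𝓝 x, DifferentiableAt ℝ f z :=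
    (hf.eventually (by simp)).mono fun z hz => hz.differentiableAt (by norm_num)
  refine ⟨2 * |C|, ?_⟩
  filter_upwards [eventually_exists_sub_eq_inner_gradient hdiff, ball_mem_nhds x hr]
    with z ⟨t, ht, heq⟩ hz
  have hmem : x + t • (z - x) ∈ ball x r :=
    (convex_ball x r).add_smul_sub_mem (mem_ball_self hr) hz (Ioo_subset_Icc_self ht)
  have h1 : ‖gradient f z - gradient f x‖ ≤ |C| * ‖z - x‖ :=
    (hball z hz).trans (by gcongr; exact le_abs_self C)
  have h2 : ‖gradient f (x + t • (z - x)) - gradient f x‖ ≤ |C| * ‖z - x‖ := by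
    refine (hball _ hmem).trans ?_
    rw [add_sub_cancel_left, norm_smul, Real.norm_of_nonneg ht.1.le]
    have h0 := ht.1.le
    gcongr
    · exact le_abs_self C
    · exact mul_le_of_le_one_left (norm_nonneg _) ht.2.le
  have h3 : ‖gradient f z - gradient f (x + t • (z - x))‖ ≤ 2 * |C| * ‖z - x‖ := by
    rw [← sub_sub_sub_cancel_right _ _ (gradient f x)]
    exact (norm_sub_le _ _).trans (by linarith)
  rw [heq, ← inner_sub_left]
  calc |⟪gradient f z - gradient f (x + t • (z - x)), z - x⟫|
      ≤ ‖gradient f z - gradient f (x + t • (z - x))‖ * ‖z - x‖ := abs_real_inner_le_norm _ _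
    _ ≤ 2 * |C| * ‖z - x‖ * ‖z - x‖ := by gcongr
    _ = 2 * |C| * ‖z - x‖ ^ 2 := by ring

/-- Along points tending to `x` in the limiting direction `w`, difference quotients converge to the
directional derivative. -/
lemma DifferentiableAt.tendsto_inner_gradient {ι : Type*} {f : E → ℝ} {x w : E}
    (hf : DifferentiableAt ℝ f x) {l : Filter ι} {p : ι → E} (hp : Tendsto p l (𝓝 x))
    (hw : Tendsto (fun k => ‖p k - x‖⁻¹ • (p k - x)) l (𝓝 w)) :
    Tendsto (fun k => ‖p k - x‖⁻¹ * (f (p k) - f x)) l (𝓝 ⟪gradient f x, w⟫) := by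
  rw [inner_gradient_left]
  exact hf.hasFDerivAt.tendsto_normalized_sub hp hw

lemma DifferentiableAt.inner_gradient_nonpos {ι : Type*} {f : E → ℝ} {x w : E}
    (hf : DifferentiableAt ℝ f x) {l : Filter ι} [l.NeBot] {p : ι → E} (hp : Tendsto p l (𝓝 x))
    (hw : Tendsto (fun k => ‖p k - x‖⁻¹ • (p k - x)) l (𝓝 w))
    (h : ∀ᶠ k in l, f (p k) ≤ f x) : ⟪gradient f x, w⟫ ≤ 0 :=
  le_of_tendsto (hf.tendsto_inner_gradient hp hw) <| h.mono fun k hk =>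
    mul_nonpos_of_nonneg_of_nonpos (by positivity) (sub_nonpos.2 hk)

lemma DifferentiableAt.inner_gradient_eq_zero {ι : Type*} {f : E → ℝ} {x w : E}
    (hf : DifferentiableAt ℝ f x) {l : Filter ι} [l.NeBot] {p : ι → E} (hp : Tendsto p l (𝓝 x))
    (hw : Tendsto (fun k => ‖p k - x‖⁻¹ • (p k - x)) l (𝓝 w))
    (h : ∀ᶠ k in l, f (p k) = f x) : ⟪gradient f x, w⟫ = 0 :=
  tendsto_nhds_unique (hf.tendsto_inner_gradient hp hw) <|
    tendsto_const_nhds.congr' <| h.mono fun k hk => by simp [hk]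

end Gradient

section KKT

variable {n m : ℕ} {φ : En n → ℝ} {g : Fin m → En n → ℝ} {z zs w : En n} {l : En m}

lemma Smooth2.contDiffAt (h : Smooth2 φ g zs) :
    ContDiffAt ℝ 2 φ zs ∧ ∀ i, ContDiffAt ℝ 2 (g i) zs := by
  obtain ⟨U, hU, hφ, hg, -⟩ := h
  exact ⟨hφ.contDiffAt hU, fun i => (hg i).contDiffAt hU⟩

lemma ContDiffAt.lagr (hφ : ContDiffAt ℝ 2 φ zs) (hg : ∀ i, ContDiffAt ℝ 2 (g i) zs) (l : En m) :
    ContDiffAt ℝ 2 (fun z => Lagr φ g z l) zs :=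
  hφ.add (ContDiffAt.sum fun i _ => contDiffAt_const.mul (hg i))

lemma gradL_eq (hφ : DifferentiableAt ℝ φ z) (hg : ∀ i, DifferentiableAt ℝ (g i) z) (l : En m) :
    gradL φ g l z = gradient φ z + ∑ i, l i • gradient (g i) z := by
  have h : HasFDerivAt (fun z' => Lagr φ g z' l)
      (fderiv ℝ φ z + ∑ i, l i • fderiv ℝ (g i) z) z :=
    hφ.hasFDerivAt.add (HasFDerivAt.fun_sum fun i _ => (hg i).hasFDerivAt.const_mul (l i))
  simp [gradL, gradient, h.fderiv, map_add, map_sum]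

lemma KKTat.mul_eq_zero (h : KKTat φ g z l) (i : Fin m) : l i * g i z = 0 :=
  (Finset.sum_eq_zero_iff_of_nonpos fun j _ =>
    mul_nonpos_of_nonneg_of_nonpos (h.2.2.1 j) (h.2.1 j)).1 h.2.2.2 i (Finset.mem_univ i)

lemma KKTat.eq_zero_of_neg (h : KKTat φ g z l) {i : Fin m} (hi : g i z < 0) : l i = 0 :=
  (_root_.mul_eq_zero.1 (h.mul_eq_zero i)).resolve_right hi.ne

lemma KKTat.eq_zero_of_pos (h : KKTat φ g z l) {i : Fin m} (hi : 0 < l i) : g i z = 0 :=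
  (_root_.mul_eq_zero.1 (h.mul_eq_zero i)).resolve_left hi.ne'

lemma KKTat.inner_gradient_add_sum (h : KKTat φ g z l) (hφ : DifferentiableAt ℝ φ z)
    (hg : ∀ i, DifferentiableAt ℝ (g i) z) (w : En n) :
    ⟪gradient φ z, w⟫ + ∑ i, l i * ⟪gradient (g i) z, w⟫ = 0 := by
  have := congrArg (fun v => ⟪v, w⟫) ((gradL_eq hφ hg l).symm.trans h.1)
  simpa [inner_add_left, sum_inner, real_inner_smul_left] using this

/-- A linearized feasible direction along which the objective does not increase to first order is
orthogonal to the gradients of all strongly active constraints. -/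
lemma inner_gradient_eq_zero_of_mem_Bplus (hφ : DifferentiableAt ℝ φ zs)
    (hg : ∀ i, DifferentiableAt ℝ (g i) zs)
    (hw : ∀ i ∈ ActB g zs, ⟪gradient (g i) zs, w⟫ ≤ 0) (hφw : ⟪gradient φ zs, w⟫ ≤ 0)
    {i : Fin m} (hi : i ∈ Bplus φ g zs) : ⟪gradient (g i) zs, w⟫ = 0 := by
  obtain ⟨-, l, hl, hpos⟩ := hi
  have hterm : ∀ j ∈ Finset.univ, l j * ⟪gradient (g j) zs, w⟫ ≤ 0 := by
    intro j _
    rcases (KKTat.mul_eq_zero hl j |> _root_.mul_eq_zero.1) with h0 | h0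
    · simp [h0]
    · exact mul_nonpos_of_nonneg_of_nonpos (hl.2.2.1 j) (hw j h0)
  have hsum := KKTat.inner_gradient_add_sum hl hφ hg w
  have hzero : ∑ j, l j * ⟪gradient (g j) zs, w⟫ = 0 :=
    le_antisymm (Finset.sum_nonpos hterm) (by linarith)
  exact (_root_.mul_eq_zero.1 ((Finset.sum_eq_zero_iff_of_nonpos hterm).1 hzero i
    (Finset.mem_univ i))).resolve_left hpos.ne'

/-- Under the second-order condition the Hessian of the Lagrangian is positive on critical unit
directions. -/
lemma SOC.inner_hessL_pos (h : SOC φ g zs) (hφ : DifferentiableAt ℝ φ zs)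
    (hg : ∀ i, DifferentiableAt ℝ (g i) zs) (hl : KKTat φ g zs l) (hnorm : ‖w‖ = 1)
    (hw : ∀ i ∈ ActB g zs, ⟪gradient (g i) zs, w⟫ ≤ 0) (hφw : ⟪gradient φ zs, w⟫ ≤ 0) :
    0 < ⟪w, hessL φ g l zs w⟫ := by
  obtain ⟨σ, hσ, hsoc⟩ := h
  have := hsoc l hl w (fun i hi => inner_gradient_eq_zero_of_mem_Bplus hφ hg hw hφw hi)
    (fun i hi => hw i hi.1)
  rw [hnorm] at this
  linarith

/-- Second-order sufficiency: near `zs` every other feasible point has a larger objective. -/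
theorem eventually_lt_of_SOC (hφ : ContDiffAt ℝ 2 φ zs) (hg : ∀ i, ContDiffAt ℝ 2 (g i) zs)
    (hl : KKTat φ g zs l) (hsoc : SOC φ g zs) :
    ∀ᶠ z in 𝓝[≠] zs, (∀ i, g i z ≤ 0) → φ zs < φ z := by
  by_contra hcon
  obtain ⟨u, hu, hP, w, hnorm, hw⟩ := exists_ultrafilter_tendsto_direction
    (not_eventually.1 hcon)
  have hφ1 : DifferentiableAt ℝ φ zs := hφ.differentiableAt (by norm_num)
  have hg1 : ∀ i, DifferentiableAt ℝ (g i) zs := fun i => (hg i).differentiableAt (by norm_num)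
  have hne : ∀ᶠ z in (u : Filter (En n)), z ≠ zs := hu self_mem_nhdsWithin
  have hux : (u : Filter (En n)) ≤ 𝓝 zs := hu.trans nhdsWithin_le_nhds
  have hpos : 0 < ⟪w, hessL φ g l zs w⟫ := by
    refine hsoc.inner_hessL_pos hφ1 hg1 hl hnorm (fun i hi => ?_) ?_
    · refine (hg1 i).inner_gradient_nonpos hux hw (hP.mono fun z hz => ?_)
      push Not at hz
      exact (hz.1 i).trans_eq (Eq.symm hi)
    · refine hφ1.inner_gradient_nonpos hux hw (hP.mono fun z hz => ?_)
      push Not at hz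
      exact hz.2
  have hL := hφ.lagr hg l
  have hmv : ∀ᶠ z in (u : Filter (En n)), ∃ t ∈ Ioo (0 : ℝ) 1,
      Lagr φ g z l - Lagr φ g zs l = ⟪gradL φ g l (zs + t • (z - zs)), z - zs⟫ :=
    hux (eventually_exists_sub_eq_inner_gradient
      ((hL.eventually (by simp)).mono fun z hz => hz.differentiableAt (by norm_num)))
  choose! t ht using fun z (hz : ∃ t ∈ Ioo (0 : ℝ) 1,
      Lagr φ g z l - Lagr φ g zs l = ⟪gradL φ g l (zs + t • (z - zs)), z - zs⟫) => hz
  have hd : Tendsto (fun z => z - zs) (u : Filter (En n)) (𝓝 0) := by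
    have : Tendsto id (u : Filter (En n)) (𝓝 zs) := hux
    simpa using this.sub_const zs
  have hp : Tendsto (fun z => zs + t z • (z - zs)) (u : Filter (En n)) (𝓝 zs) := by
    have : Tendsto (fun z => t z • (z - zs)) (u : Filter (En n)) (𝓝 0) := by
      refine squeeze_zero_norm' ?_ (tendsto_zero_iff_norm_tendsto_zero.1 hd)
      filter_upwards [hmv] with z hz
      obtain ⟨h01, -⟩ := ht z hz
      rw [norm_smul, Real.norm_of_nonneg h01.1.le]
      exact mul_le_of_le_one_left (norm_nonneg _) h01.2.le
    simpa using this.const_add zs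
  refine hpos.not_ge (hL.differentiableAt_gradient.hasFDerivAt.inner_apply_nonpos hl.1 hp ?_ ?_
    tendsto_const_nhds (e := fun _ => 0) ?_)
  · filter_upwards [hmv, hne] with z hz hz'
    simpa [sub_eq_zero, hz'] using (ht z hz).1.1.ne'
  · refine hw.congr' ?_
    filter_upwards [hmv] with z hz
    have h0 := (ht z hz).1.1
    rw [add_sub_cancel_left, norm_smul, smul_smul, Real.norm_of_nonneg h0.le, mul_inv,
      mul_right_comm, inv_mul_cancel₀ h0.ne', one_mul]
  · filter_upwards [hmv, hP] with z hz hz'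
    obtain ⟨h01, heq⟩ := ht z hz
    push Not at hz'
    have hle : Lagr φ g z l - Lagr φ g zs l ≤ 0 := by
      have : ∑ i, l i * g i z ≤ 0 := Finset.sum_nonpos fun i _ =>
        mul_nonpos_of_nonneg_of_nonpos (hl.2.2.1 i) (hz'.1 i)
      simp only [Lagr, hl.2.2.2]
      linarith [hz'.2]
    rw [heq] at hle
    rw [add_sub_cancel_left, real_inner_smul_left, zero_mul, real_inner_comm]
    exact mul_nonpos_of_nonneg_of_nonpos h01.1.le hle

/-- Under MFCQ, multipliers at stationary points near `zs` converge along ultrafilters, the limit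
being a multiplier at `zs`. -/
lemma MFCQ.exists_tendsto_multiplier (h : MFCQ g zs) (hφ : ContDiffAt ℝ 2 φ zs)
    (hg : ∀ i, ContDiffAt ℝ 2 (g i) zs) (hfeas : ∀ i, g i zs ≤ 0) {u : Ultrafilter (En n)}
    (hu : (u : Filter (En n)) ≤ 𝓝 zs) {lam : En n → En m}
    (hlam : ∀ᶠ z in (u : Filter (En n)), KKTat φ g z (lam z)) :
    ∃ ls : En m, KKTat φ g zs ls ∧ ∀ i, Tendsto (fun z => lam z i) u (𝓝 (ls i)) := by
  obtain ⟨y, hy⟩ := h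
  have hφ1 : ∀ᶠ z in (u : Filter (En n)), DifferentiableAt ℝ φ z :=
    hu ((hφ.eventually (by simp)).mono fun z hz => hz.differentiableAt (by norm_num))
  have hg1 : ∀ᶠ z in (u : Filter (En n)), ∀ i, DifferentiableAt ℝ (g i) z :=
    eventually_all.2 fun i =>
      hu (((hg i).eventually (by simp)).mono fun z hz => hz.differentiableAt (by norm_num))
  have hφlim : Tendsto (gradient φ) u (𝓝 (gradient φ zs)) :=
    hφ.differentiableAt_gradient.continuousAt.tendsto.mono_left hu
  have hglim : ∀ i, Tendsto (gradient (g i)) u (𝓝 (gradient (g i) zs)) := fun i =>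
    (hg i).differentiableAt_gradient.continuousAt.tendsto.mono_left hu
  have hgval : ∀ i, Tendsto (g i) u (𝓝 (g i zs)) := fun i =>
    (hg i).continuousAt.tendsto.mono_left hu
  have hinact : ∀ᶠ z in (u : Filter (En n)), ∀ i, i ∉ ActB g zs → g i z < 0 :=
    eventually_all.2 fun i => by
      by_cases hi : i ∈ ActB g zs
      · simp [hi]
      · filter_upwards [(hgval i).eventually_lt_const (lt_of_le_of_ne (hfeas i) hi)] with z hz _
        exact hz
  have hact : ∀ᶠ z in (u : Filter (En n)), ∀ i, i ∈ ActB g zs →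
      ⟪gradient (g i) z, y⟫ < ⟪gradient (g i) zs, y⟫ / 2 :=
    eventually_all.2 fun i => by
      by_cases hi : i ∈ ActB g zs
      · have hlt := hy i hi
        filter_upwards [((hglim i).inner tendsto_const_nhds).eventually_lt_const
          (show ⟪gradient (g i) zs, y⟫ < ⟪gradient (g i) zs, y⟫ / 2 by linarith)] with z hz _
        exact hz
      · simp [hi]
  have hbd : ∀ᶠ z in (u : Filter (En n)), ⟪gradient φ z, y⟫ < ⟪gradient φ zs, y⟫ + 1 :=
    (hφlim.inner tendsto_const_nhds).eventually_lt_const (lt_add_one _)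
  have hconv : ∀ i, ∃ a, Tendsto (fun z => lam z i) u (𝓝 a) := by
    intro i
    suffices ∃ M, ∀ᶠ z in (u : Filter (En n)), lam z i ∈ Icc 0 M by
      obtain ⟨M, hM⟩ := this
      obtain ⟨a, -, ha⟩ := isCompact_Icc.ultrafilter_le_nhds (u.map fun z => lam z i)
        (le_principal_iff.2 hM)
      exact ⟨a, ha⟩
    by_cases hi : i ∈ ActB g zs
    · have hyi := hy i hi
      refine ⟨(⟪gradient φ zs, y⟫ + 1) / (-(⟪gradient (g i) zs, y⟫ / 2)), ?_⟩
      filter_upwards [hφ1, hg1, hinact, hact, hbd, hlam] with z h1 h2 h3 h4 h5 hk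
      refine ⟨hk.2.2.1 i, ?_⟩
      have hsum := hk.inner_gradient_add_sum h1 h2 y
      have hterm : ∀ j ∈ Finset.univ, 0 ≤ -(lam z j * ⟪gradient (g j) z, y⟫) := by
        intro j _
        by_cases hj : j ∈ ActB g zs
        · have := hy j hj
          have := h4 j hj
          exact neg_nonneg.2 (mul_nonpos_of_nonneg_of_nonpos (hk.2.2.1 j) (by linarith))
        · simp [hk.eq_zero_of_neg (h3 j hj)]
      have hle := Finset.single_le_sum hterm (Finset.mem_univ i)
      rw [Finset.sum_neg_distrib] at hle
      rw [le_div_iff₀ (by linarith)]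
      have := mul_le_mul_of_nonneg_left (h4 i hi).le (hk.2.2.1 i)
      linarith
    · refine ⟨0, ?_⟩
      filter_upwards [hinact, hlam] with z h3 hk
      simp [hk.eq_zero_of_neg (h3 i hi)]
  choose a ha using hconv
  refine ⟨WithLp.toLp 2 a, ⟨?_, hfeas, fun i => ?_, ?_⟩, ha⟩
  · have hlim : Tendsto (fun z => gradient φ z + ∑ i, lam z i • gradient (g i) z) u
        (𝓝 (gradient φ zs + ∑ i, a i • gradient (g i) zs)) :=
      hφlim.add (tendsto_finsetSum _ fun i _ => (ha i).smul (hglim i))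
    rw [gradL_eq (hφ.differentiableAt (by norm_num))
      (fun i => (hg i).differentiableAt (by norm_num))]
    refine tendsto_nhds_unique hlim (tendsto_const_nhds.congr' ?_)
    filter_upwards [hφ1, hg1, hlam] with z h1 h2 hk
    rw [← gradL_eq h1 h2, hk.1]
  · exact ge_of_tendsto (ha i) (hlam.mono fun z hk => hk.2.2.1 i)
  · refine tendsto_nhds_unique (tendsto_finsetSum _ fun i _ => (ha i).mul (hgval i))
      (tendsto_const_nhds.congr' (hlam.mono fun z hk => hk.2.2.2.symm))

/-- Under MFCQ and the second-order condition, `zs` is an isolated stationary point. -/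
theorem eventually_not_KKTat (hφ : ContDiffAt ℝ 2 φ zs) (hg : ∀ i, ContDiffAt ℝ 2 (g i) zs)
    (hl : KKTat φ g zs l) (hmf : MFCQ g zs) (hsoc : SOC φ g zs) :
    ∀ᶠ z in 𝓝[≠] zs, ¬ ∃ l : En m, KKTat φ g z l := by
  by_contra hcon
  obtain ⟨u, hu, hP, w, hnorm, hw⟩ := exists_ultrafilter_tendsto_direction
    (not_eventually.1 hcon)
  simp only [not_not] at hP
  have hne : ∀ᶠ z in (u : Filter (En n)), z ≠ zs := hu self_mem_nhdsWithin
  have hux : (u : Filter (En n)) ≤ 𝓝 zs := hu.trans nhdsWithin_le_nhds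
  choose! lam hlam' using fun z (hz : ∃ l : En m, KKTat φ g z l) => hz
  have hlam : ∀ᶠ z in (u : Filter (En n)), KKTat φ g z (lam z) := hP.mono hlam'
  obtain ⟨ls, hls, hlim⟩ := hmf.exists_tendsto_multiplier hφ hg hl.2.1 hux hlam
  have hφ1 : DifferentiableAt ℝ φ zs := hφ.differentiableAt (by norm_num)
  have hg1 : ∀ i, DifferentiableAt ℝ (g i) zs := fun i => (hg i).differentiableAt (by norm_num)
  have hφ2 : ∀ᶠ z in (u : Filter (En n)), DifferentiableAt ℝ φ z :=
    hux ((hφ.eventually (by simp)).mono fun z hz => hz.differentiableAt (by norm_num))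
  have hg2 : ∀ᶠ z in (u : Filter (En n)), ∀ i, DifferentiableAt ℝ (g i) z :=
    eventually_all.2 fun i =>
      hux (((hg i).eventually (by simp)).mono fun z hz => hz.differentiableAt (by norm_num))
  have hpos : 0 < ⟪w, hessL φ g ls zs w⟫ := by
    refine hsoc.inner_hessL_pos hφ1 hg1 hls hnorm (fun i hi => ?_) ?_
    · exact (hg1 i).inner_gradient_nonpos hux hw
        (hlam.mono fun z hz => (hz.2.1 i).trans_eq (Eq.symm hi))
    · have hzero : ∑ i, ls i * ⟪gradient (g i) zs, w⟫ = 0 := by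
        refine Finset.sum_eq_zero fun i _ => ?_
        rcases (hls.2.2.1 i).eq_or_lt with h0 | h0
        · simp [← h0]
        · rw [(hg1 i).inner_gradient_eq_zero hux hw, mul_zero]
          filter_upwards [hlam, (hlim i).eventually_const_lt h0] with z hz hz'
          exact (hz.eq_zero_of_pos hz').trans (hls.eq_zero_of_pos h0).symm
      linarith [hls.inner_gradient_add_sum hφ1 hg1 w]
  choose C hC using fun i => (hg i).exists_abs_inner_gradient_sub_le
  have he : Tendsto (fun z => ∑ i, |lam z i - ls i| * C i) u (𝓝 0) := by
    have : Tendsto (fun z => ∑ i, |lam z i - ls i| * C i) u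
        (𝓝 (∑ i, |ls i - ls i| * C i)) :=
      tendsto_finsetSum _ fun i _ => ((hlim i).sub_const (ls i)).abs.mul_const (C i)
    simpa using this
  refine hpos.not_ge ((hφ.lagr hg ls).differentiableAt_gradient.hasFDerivAt.inner_apply_nonpos
    hls.1 hux hne hw he ?_)
  filter_upwards [hlam, hφ2, hg2, hux (eventually_all.2 hC)] with z hk h1 h2 h3
  change ⟪z - zs, gradL φ g ls z⟫ ≤ _
  have hstat := hk.inner_gradient_add_sum h1 h2 (z - zs)
  have hterm : ∀ i, -((lam z i - ls i) * ⟪gradient (g i) z, z - zs⟫) ≤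
      |lam z i - ls i| * C i * ‖z - zs‖ ^ 2 := by
    intro i
    have hsign : 0 ≤ (lam z i - ls i) * (g i z - g i zs) := by
      have := mul_nonpos_of_nonneg_of_nonpos (hls.2.2.1 i) (hk.2.1 i)
      have := mul_nonpos_of_nonneg_of_nonpos (hk.2.2.1 i) (hls.2.1 i)
      linarith [hk.mul_eq_zero i, hls.mul_eq_zero i]
    have herr : -((lam z i - ls i) * (⟪gradient (g i) z, z - zs⟫ - (g i z - g i zs))) ≤
        |lam z i - ls i| * C i * ‖z - zs‖ ^ 2 := by
      refine (neg_le_abs _).trans ?_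
      rw [abs_mul, mul_assoc]
      exact mul_le_mul_of_nonneg_left (h3 i) (abs_nonneg _)
    linarith
  calc ⟪z - zs, gradL φ g ls z⟫
      = ⟪gradient φ z, z - zs⟫ + ∑ i, ls i * ⟪gradient (g i) z, z - zs⟫ := by
        rw [gradL_eq h1 h2, real_inner_comm, inner_add_left, sum_inner]
        simp only [real_inner_smul_left]
    _ = ∑ i, -((lam z i - ls i) * ⟪gradient (g i) z, z - zs⟫) := by
        simp only [sub_mul, neg_sub, Finset.sum_sub_distrib]
        linarith
    _ ≤ ∑ i, |lam z i - ls i| * C i * ‖z - zs‖ ^ 2 := Finset.sum_le_sum fun i _ => hterm i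
    _ = (∑ i, |lam z i - ls i| * C i) * ‖z - zs‖ ^ 2 := (Finset.sum_mul _ _ _).symm

end KKT

/-- Theorem 2.1: under Assumption A, z* is an isolated stationary point and a strict local
minimizer of NLP. -/
theorem stmt_0 {n m : ℕ} (φ : En n → ℝ) (g : Fin m → En n → ℝ) (zs : En n)
    (hA : AssumpA φ g zs) :
    ∃ ε : ℝ, 0 < ε ∧
      (∀ z : En n, ‖z - zs‖ ≤ ε → (∃ l : En m, KKTat φ g z l) → z = zs) ∧
      (∀ z : En n, ‖z - zs‖ ≤ ε → z ≠ zs → (∀ i, g i z ≤ 0) → φ zs < φ z) := by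
  obtain ⟨hsmooth, ⟨l, hl⟩, hmf, hsoc⟩ := hA
  obtain ⟨hφ, hg⟩ := hsmooth.contDiffAt
  have hev := (eventually_not_KKTat hφ hg hl hmf hsoc).and (eventually_lt_of_SOC hφ hg hl hsoc)
  obtain ⟨r, hr, hball⟩ := Metric.eventually_nhds_iff.1 (eventually_nhdsWithin_iff.1 hev)
  have hmem : ∀ z : En n, ‖z - zs‖ ≤ r / 2 → dist z zs < r := fun z hz => by
    rw [dist_eq_norm]
    linarith
  refine ⟨r / 2, half_pos hr, fun z hz hkkt => ?_, fun z hz hne hfeas => ?_⟩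
  · by_contra hne
    exact (hball (hmem z hz) hne).1 hkkt
  · exact (hball (hmem z hz) hne).2 hfeas
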